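/- Let Λ be a generic interlacing sequence with concave corner set 𝕏 and let u_0 be a real number. Then for every n ≥ 1, the moment M_n(Λ, u_0) equals n! · Σ_{(a_1,...,a_ℓ) composition of n} Σ_{x_ℓ < ... < x_1 ≤ u_0, x_i ∈ 𝕏} [ ∏_{i=1}^{ℓ} ( (μ_Λ(x_i)/a_i) · ∏_{r=1}^{a_i − 1} ( Σ_{x' ∈ 𝕏} μ_Λ(x')/(x' − x_i + r) ) ) ] · [ Σ_{G ∈ MS_ℓ} β_G / ∏_{(i,j) ∈ E_G} (x_j − x_i + a_i) ], where β_G = (−1)^ℓ · (∏_{j=1}^{ℓ} a_j) / ∏_{S} ((−1) · Σ_{i ∈ S} a_i), the product being over the vertex sets S of the connected components of G. -/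

import Mathlib

open Finset

open scoped Classical

/-- `(x_0, ..., x_L; y_1, ..., y_L)` is an interlacing sequence:
`x_0 < y_1 < x_1 < ... < y_L < x_L`. -/
def IsInterlacing (L : ℕ) (X : Fin (L + 1) → ℝ) (Y : Fin L → ℝ) : Prop :=
  ∀ k : Fin L, X k.castSucc < Y k ∧ Y k < X k.succ

/-- The interlacing sequence is generic: no difference of two distinct concave
corners is an integer. -/
def IsGeneric (L : ℕ) (X : Fin (L + 1) → ℝ) : Prop :=
  ∀ i j : Fin (L + 1), i ≠ j → ∀ m : ℤ, X i - X j ≠ (m : ℝ)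

/-- The Cauchy transform `G_Λ(z) = ∏ (z - y_k) / ∏ (z - x_k)`. -/
noncomputable def cauchyG (L : ℕ) (X : Fin (L + 1) → ℝ) (Y : Fin L → ℝ) (z : ℝ) : ℝ :=
  (∏ k, (z - Y k)) / (∏ k, (z - X k))

/-- The transition measure weight
`μ_Λ(x_i) = ∏_k (x_i - y_k) / ∏_{k ≠ i} (x_i - x_k)`. -/
noncomputable def muWeight (L : ℕ) (X : Fin (L + 1) → ℝ) (Y : Fin L → ℝ)
    (i : Fin (L + 1)) : ℝ :=
  (∏ k, (X i - Y k)) / (∏ k ∈ univ.erase i, (X i - X k))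

/-- The falling product `G_Λ^⟨k⟩(z) = G_Λ(z) G_Λ(z-1) ⋯ G_Λ(z-k+1)`. -/
noncomputable def cauchyGFall (L : ℕ) (X : Fin (L + 1) → ℝ) (Y : Fin L → ℝ)
    (k : ℕ) (z : ℝ) : ℝ :=
  ∏ t ∈ Finset.range k, cauchyG L X Y (z - t)

/-- `Θ(x_1, ..., x_ℓ)` with parameters `a_1, ..., a_ℓ`. -/
noncomputable def Theta (ℓ : ℕ) (a x : Fin ℓ → ℝ) : ℝ :=
  ∏ i : Fin ℓ, ∏ j ∈ univ.filter (fun j => i < j),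
    ((x i - x j) * (x i - x j - a i + a j)) /
      ((x i - x j + a j) * (x i - x j - a i))

/-- The tuples `x_1 > x_2 > ... > x_ℓ` of concave corners with `x_1 ≤ u_0`,
encoded by tuples of indices. -/
noncomputable def decTuples (L : ℕ) (X : Fin (L + 1) → ℝ) (u₀ : ℝ) (ℓ : ℕ) :
    Finset (Fin ℓ → Fin (L + 1)) :=
  univ.filter (fun r =>
    (∀ i j : Fin ℓ, i < j → X (r j) < X (r i)) ∧ (∀ i, X (r i) ≤ u₀))

/-- The `n`-th moment `M_n(Λ, u_0)` of a generic interlacing sequence. -/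
noncomputable def momentM (L : ℕ) (X : Fin (L + 1) → ℝ) (Y : Fin L → ℝ)
    (u₀ : ℝ) (n : ℕ) : ℝ :=
  (n.factorial : ℝ) *
    ∑ c : Composition n, ∑ r ∈ decTuples L X u₀ c.length,
      Theta c.length (fun i => (c.blocksFun i : ℝ)) (fun i => X (r i)) *
        ∏ i, ((-1 : ℝ) ^ (c.blocksFun i - 1) / (c.blocksFun i : ℝ)) *
          muWeight L X Y (r i) *
          cauchyGFall L X Y (c.blocksFun i - 1) (X (r i) - 1)

/-- The edge relation of a directed graph on `Fin ℓ` given by its edge set. -/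
def edgeRel (ℓ : ℕ) (E : Finset (Fin ℓ × Fin ℓ)) (i j : Fin ℓ) : Prop := (i, j) ∈ E

/-- A multi-spine graph: a directed graph each of whose connected components is a
directed path. -/
def IsMultiSpine (ℓ : ℕ) (E : Finset (Fin ℓ × Fin ℓ)) : Prop :=
  (∀ i j j' : Fin ℓ, (i, j) ∈ E → (i, j') ∈ E → j = j') ∧
  (∀ i i' j : Fin ℓ, (i, j) ∈ E → (i', j) ∈ E → i = i') ∧
  (∀ i : Fin ℓ, ¬ Relation.TransGen (edgeRel ℓ E) i i)

/-- The starting points of the directed paths (vertices with no incoming edge). -/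
noncomputable def spineHeads (ℓ : ℕ) (E : Finset (Fin ℓ × Fin ℓ)) : Finset (Fin ℓ) :=
  univ.filter (fun v => ∀ u, (u, v) ∉ E)

/-- The vertex set of the connected component containing the head `v`. -/
noncomputable def spineComponent (ℓ : ℕ) (E : Finset (Fin ℓ × Fin ℓ)) (v : Fin ℓ) :
    Finset (Fin ℓ) :=
  univ.filter (fun w => Relation.ReflTransGen (edgeRel ℓ E) v w)

/-- The constant `β_G`. -/
noncomputable def betaMS (ℓ : ℕ) (a : Fin ℓ → ℝ) (E : Finset (Fin ℓ × Fin ℓ)) : ℝ :=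
  (-1 : ℝ) ^ ℓ * (∏ j, a j) /
    ∏ v ∈ spineHeads ℓ E, ((-1) * ∑ i ∈ spineComponent ℓ E v, a i)

open Equiv.Perm in
/-- The sign of a permutation in terms of its number of cycles, fixed points included. -/
lemma sign_eq_neg_one_pow_card_add_card_sameCycle {α : Type*} [Fintype α] [DecidableEq α]
    (σ : Equiv.Perm α) :
    Equiv.Perm.sign σ =
      (-1) ^ (Fintype.card α + Fintype.card (Quotient (SameCycle.setoid σ))) := by
  let := SameCycle.setoid σ
  have hfix : #{q : Quotient (SameCycle.setoid σ) | q.out ∉ σ.support} = #σ.supportᶜ := by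
    refine card_bij (fun q _ => q.out) (fun q hq => by simpa using hq)
      (fun q _ q' _ h => Quotient.out_injective h) fun x hx => ?_
    have hx' : σ x = x := by simpa using hx
    have hout : (⟦x⟧ : Quotient (SameCycle.setoid σ)).out = x := by
      have h : σ.SameCycle x (⟦x⟧ : Quotient (SameCycle.setoid σ)).out :=
        Setoid.symm (Quotient.mk_out x)
      exact (h.eq_of_left hx').symm
    exact ⟨⟦x⟧, by simp [hout, hx'], hout⟩
  have hcyc : #{q : Quotient (SameCycle.setoid σ) | q.out ∈ σ.support} =
      #σ.cycleFactorsFinset := by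
    refine card_bij (fun q _ => σ.cycleOf q.out)
      (fun q hq => cycleOf_mem_cycleFactorsFinset_iff.2 (by simpa using hq))
      (fun q hq q' hq' h => ?_) fun c hc => ?_
    · exact Quotient.out_equiv_out.1
        ((sameCycle_iff_cycleOf_eq_of_mem_support (by simpa using hq) (by simpa using hq')).2 h)
    · obtain ⟨x, hx⟩ := (mem_cycleFactorsFinset_iff.1 hc).1.nonempty_support
      have hcx := cycle_is_cycleOf hx hc
      have hxσ : x ∈ σ.support := mem_cycleFactorsFinset_support_le hc hx
      have h : σ.SameCycle (⟦x⟧ : Quotient (SameCycle.setoid σ)).out x := Quotient.mk_out x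
      refine ⟨⟦x⟧, ?_, by rw [h.cycleOf_eq, hcx]⟩
      simpa using fun h0 => (mem_support.1 hxσ) (h.apply_eq_self_iff.1 h0)
  have hcard : Fintype.card (Quotient (SameCycle.setoid σ)) =
      #σ.cycleFactorsFinset + #σ.supportᶜ := by
    rw [← hfix, ← hcyc, card_filter_add_card_filter_not, card_univ]
  have hsum : #σ.support + #σ.supportᶜ = Fintype.card α := card_add_card_compl _
  rw [sign_of_cycleType, sum_cycleType, hcard, ← hsum, cycleType_def, Multiset.card_map,
    card_val]
  rw [show #σ.support + #σ.supportᶜ + (#σ.cycleFactorsFinset + #σ.supportᶜ) =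
    #σ.support + #σ.cycleFactorsFinset + 2 * #σ.supportᶜ by ring, pow_add _ _ (2 * _),
    pow_mul, neg_one_sq, one_pow, mul_one]

/-- The Cauchy determinant. -/
lemma det_cauchy {K : Type*} [Field K] (n : ℕ) (x y : Fin n → K)
    (h : ∀ i j, x i - y j ≠ 0) :
    (Matrix.of fun i j => (x i - y j)⁻¹).det =
      (∏ i, (x i - y i)⁻¹) * ∏ i, ∏ j ∈ univ.filter (fun j => i < j),
        ((x i - x j) * (y j - y i)) / ((x j - y i) * (x i - y j)) := by
  induction n with
  | zero => simp
  | succ n ih =>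
    have hrow := Matrix.det_eq_of_forall_row_eq_smul_add_const
      (A := Matrix.of fun i j => (x i - y j)⁻¹)
      (B := Matrix.of fun i j => if i = 0 then (x 0 - y j)⁻¹ else
        ((x 0 - x i) / (x i - y 0)) * (((y j - y 0) / (x 0 - y j)) * (x i - y j)⁻¹))
      (fun i => if i = 0 then 0 else (x 0 - y 0) / (x i - y 0)) 0 (by simp)
      (fun i j => by
        rcases eq_or_ne i 0 with rfl | hi
        · simp
        · have h1 := h i j
          have h2 := h 0 j
          have h3 := h i 0
          simp only [Matrix.of_apply, hi, if_false, if_true]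
          field_simp
          ring)
    rw [hrow, Matrix.det_succ_column_zero, Fin.sum_univ_succ]
    have hsub : (Matrix.of fun i j => if i = 0 then (x 0 - y j)⁻¹ else
        ((x 0 - x i) / (x i - y 0)) * (((y j - y 0) / (x 0 - y j)) * (x i - y j)⁻¹)).submatrix
          (Fin.succAbove 0) Fin.succ =
        Matrix.of fun i j : Fin n => ((x 0 - x i.succ) / (x i.succ - y 0)) *
          (Matrix.of fun i j : Fin n => ((y j.succ - y 0) / (x 0 - y j.succ)) *
            (Matrix.of fun i j : Fin n => (x i.succ - y j.succ)⁻¹) i j) i j := by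
      ext i j
      simp
    rw [hsub, Matrix.det_mul_column, Matrix.det_mul_row,
      ih (fun i => x i.succ) (fun i => y i.succ) fun i j => h _ _, Fin.prod_univ_succ,
      Fin.prod_univ_succ (fun i => ∏ j ∈ univ.filter (fun j => i < j), _)]
    have h0 : (univ.filter fun j : Fin (n + 1) => 0 < j) = univ.map (Fin.succEmb n) := by
      ext j
      cases j using Fin.cases <;> simp
    have hs : ∀ i : Fin n, (univ.filter fun j : Fin (n + 1) => i.succ < j) =
        (univ.filter fun j : Fin n => i < j).map (Fin.succEmb n) := by
      intro i
      ext j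
      cases j using Fin.cases <;> simp
    simp only [h0, hs, prod_map, Fin.coe_succEmb, prod_div_distrib, prod_mul_distrib]
    simp
    ring

/-- Partial fraction expansion of the Cauchy transform. -/
lemma cauchyG_eq_sum_muWeight (L : ℕ) (X : Fin (L + 1) → ℝ) (Y : Fin L → ℝ)
    (hX : Function.Injective X) (z : ℝ) (hz : ∀ i, z ≠ X i) :
    cauchyG L X Y z = ∑ j, muWeight L X Y j / (z - X j) := by
  set P : Polynomial ℝ := ∏ k, (Polynomial.X - Polynomial.C (Y k)) with hP
  have hdeg : P.degree < #(univ : Finset (Fin (L + 1))) := by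
    rw [hP, Polynomial.degree_prod]
    simp
    exact_mod_cast Nat.lt_succ_self L
  have hPeval : ∀ w, P.eval w = ∏ k, (w - Y k) := fun w => by
    simp [hP, Polynomial.eval_prod]
  have h := congrArg (Polynomial.eval z) (Lagrange.eq_interpolate (hX.injOn) hdeg)
  rw [Lagrange.eval_interpolate_not_at_node _ (fun i _ => hz i), hPeval] at h
  have hne : ∏ k, (z - X k) ≠ 0 := prod_ne_zero_iff.2 fun k _ => sub_ne_zero.2 (hz k)
  rw [cauchyG, h, Lagrange.eval_nodal, mul_div_cancel_left₀ _ hne]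
  refine sum_congr rfl fun i _ => ?_
  rw [hPeval, muWeight, Lagrange.nodalWeight, prod_inv_distrib]
  simp only [div_eq_mul_inv]
  ring

/-- Expanding a product of sums over the fibres of `f` as a sum over transversals of `f`. -/
lemma sum_transversal_prod {α β R : Type*} [Fintype α] [Fintype β] [CommSemiring R]
    (f : α → β) (g : α → R) :
    ∑ T ∈ univ.filter (fun T : Finset α => ∀ b, ∃! t, t ∈ T ∧ f t = b), ∏ t ∈ T, g t =
      ∏ b, ∑ t ∈ univ.filter (fun t => f t = b), g t := by
  rw [prod_univ_sum]
  symm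
  have hf : ∀ p ∈ Fintype.piFinset (fun b => univ.filter fun t => f t = b), ∀ b,
      f (p b) = b := fun p hp b => by simpa using Fintype.mem_piFinset.1 hp b
  have hinj : ∀ p ∈ Fintype.piFinset (fun b => univ.filter fun t => f t = b),
      Function.Injective p := fun p hp b b' h => by
    rw [← hf p hp b, ← hf p hp b', h]
  refine sum_bij (fun p _ => univ.image p) (fun p hp => ?_) (fun p hp p' hp' h => ?_)
    (fun T hT => ?_) fun p hp => ?_
  · simp only [mem_filter, mem_univ, true_and]
    refine fun b => ⟨p b, ⟨mem_image_of_mem _ (mem_univ b), hf p hp b⟩, ?_⟩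
    rintro t ⟨ht, rfl⟩
    obtain ⟨b, -, rfl⟩ := mem_image.1 ht
    rw [hf p hp b]
  · funext b
    have hb : p b ∈ univ.image p' := h ▸ mem_image_of_mem p (mem_univ b)
    obtain ⟨b', -, hb'⟩ := mem_image.1 hb
    rw [← hb', ← hf p hp b, ← hb', hf p' hp' b']
  · have hT' : ∀ b, ∃! t, t ∈ T ∧ f t = b := by simpa using hT
    choose p hp hu using hT'
    refine ⟨p, Fintype.mem_piFinset.2 fun b => by simpa using (hp b).2, ?_⟩
    ext t
    simp only [mem_image, mem_univ, true_and]
    refine ⟨?_, fun ht => ⟨f t, (hu (f t) t ⟨ht, rfl⟩).symm⟩⟩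
    rintro ⟨b, rfl⟩
    exact (hp b).1
  · exact (prod_image fun b _ b' _ h => hinj p hp h).symm

/-- `T` meets every cycle of `σ`, fixed points included, in exactly one point. -/
def IsCycleTransversal {ℓ : ℕ} (σ : Equiv.Perm (Fin ℓ)) (T : Finset (Fin ℓ)) : Prop :=
  ∀ j, ∃! t, t ∈ T ∧ σ.SameCycle j t

/-- The edges `j → σ j` with `j ∉ T`. -/
noncomputable def cutEdges {ℓ : ℕ} (σ : Equiv.Perm (Fin ℓ)) (T : Finset (Fin ℓ)) :
    Finset (Fin ℓ × Fin ℓ) :=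
  Tᶜ.image fun j => (j, σ j)

section CutEdges

variable {ℓ : ℕ} {σ : Equiv.Perm (Fin ℓ)} {T : Finset (Fin ℓ)}

lemma mem_cutEdges {i j : Fin ℓ} : (i, j) ∈ cutEdges σ T ↔ i ∉ T ∧ σ i = j := by
  simp only [cutEdges, mem_image, mem_compl, Prod.mk.injEq]
  exact ⟨fun ⟨k, hk, hki, hkj⟩ => hki ▸ ⟨hk, hkj⟩, fun h => ⟨i, h.1, rfl, h.2⟩⟩

lemma IsCycleTransversal.eq (hT : IsCycleTransversal σ T) {t t' : Fin ℓ} (ht : t ∈ T)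
    (ht' : t' ∈ T) (h : σ.SameCycle t t') : t = t' :=
  (hT t).unique ⟨ht, Equiv.Perm.SameCycle.refl _ _⟩ ⟨ht', h⟩

lemma sameCycle_of_reflTransGen {i j : Fin ℓ}
    (h : Relation.ReflTransGen (edgeRel ℓ (cutEdges σ T)) i j) : σ.SameCycle i j := by
  induction h with
  | refl => exact Equiv.Perm.SameCycle.refl _ _
  | tail _ hbc ih =>
    rw [← (mem_cutEdges.1 hbc).2]
    exact ih.trans (Equiv.Perm.sameCycle_apply_right.2 (Equiv.Perm.SameCycle.refl _ _))

lemma IsCycleTransversal.reflTransGen_of_sameCycle (hT : IsCycleTransversal σ T)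
    {t j : Fin ℓ} (ht : t ∈ T) (h : σ.SameCycle t j) :
    Relation.ReflTransGen (edgeRel ℓ (cutEdges σ T)) (σ t) j := by
  have key : ∀ n : ℕ,
      Relation.ReflTransGen (edgeRel ℓ (cutEdges σ T)) (σ t) ((σ ^ n) (σ t)) := by
    intro n
    induction n with
    | zero => exact .refl
    | succ n ih =>
      rw [pow_succ', Equiv.Perm.mul_apply]
      by_cases hmem : (σ ^ n) (σ t) ∈ T
      · have hsame : σ.SameCycle t ((σ ^ n) (σ t)) :=
          (Equiv.Perm.sameCycle_apply_left.1 (sameCycle_of_reflTransGen ih))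
        rw [← hT.eq ht hmem hsame]
      · exact ih.tail (mem_cutEdges.2 ⟨hmem, rfl⟩)
  obtain ⟨n, -, hn⟩ := (Equiv.Perm.sameCycle_apply_left.2 h).exists_pow_eq'
  exact hn ▸ key n

lemma IsCycleTransversal.isMultiSpine (hT : IsCycleTransversal σ T) :
    IsMultiSpine ℓ (cutEdges σ T) := by
  refine ⟨fun i j j' h h' => ?_, fun i i' j h h' => ?_, fun i hi => ?_⟩
  · rw [← (mem_cutEdges.1 h).2, ← (mem_cutEdges.1 h').2]
  · exact σ.injective ((mem_cutEdges.1 h).2.trans (mem_cutEdges.1 h').2.symm)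
  · have key : ∀ n : ℕ, Relation.TransGen (edgeRel ℓ (cutEdges σ T))
        ((σ ^ n) i) ((σ ^ n) i) := by
      intro n
      induction n with
      | zero => exact hi
      | succ n ih =>
        rw [pow_succ', Equiv.Perm.mul_apply]
        obtain ⟨k, hk, hk'⟩ := Relation.TransGen.head'_iff.1 ih
        obtain ⟨h1, rfl⟩ := mem_cutEdges.1 hk
        exact Relation.TransGen.tail' hk' hk
    obtain ⟨t, ⟨ht, hit⟩, -⟩ := hT i
    obtain ⟨n, -, rfl⟩ := hit.exists_pow_eq'
    obtain ⟨k, hk, -⟩ := Relation.TransGen.head'_iff.1 (key n)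
    exact (mem_cutEdges.1 hk).1 ht

lemma mem_iff_forall_not_mem_cutEdges {j : Fin ℓ} :
    j ∈ T ↔ ∀ k, (j, k) ∉ cutEdges σ T := by
  refine ⟨fun hj k hk => (mem_cutEdges.1 hk).1 hj, fun h => ?_⟩
  by_contra hj
  exact h _ (mem_cutEdges.2 ⟨hj, rfl⟩)

lemma spineHeads_cutEdges : spineHeads ℓ (cutEdges σ T) = T.image σ := by
  ext v
  simp only [spineHeads, mem_filter, mem_univ, true_and, mem_image, mem_cutEdges, not_and,
    not_imp_not]
  exact ⟨fun h => ⟨σ.symm v, h _ (by simp), by simp⟩,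
    fun ⟨t, ht, htv⟩ u huv => σ.injective (huv.trans htv.symm) ▸ ht⟩

lemma IsCycleTransversal.spineComponent_cutEdges (hT : IsCycleTransversal σ T)
    {t : Fin ℓ} (ht : t ∈ T) :
    spineComponent ℓ (cutEdges σ T) (σ t) = univ.filter fun j => σ.SameCycle t j := by
  ext j
  simp only [spineComponent, mem_filter, mem_univ, true_and]
  exact ⟨fun h => Equiv.Perm.sameCycle_apply_left.1 (sameCycle_of_reflTransGen h),
    hT.reflTransGen_of_sameCycle ht⟩

lemma IsCycleTransversal.cutEdges_injective {σ' : Equiv.Perm (Fin ℓ)} {T' : Finset (Fin ℓ)}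
    (hT : IsCycleTransversal σ T) (hT' : IsCycleTransversal σ' T')
    (h : cutEdges σ T = cutEdges σ' T') : σ = σ' ∧ T = T' := by
  have hTT : T = T' := by
    ext j
    rw [mem_iff_forall_not_mem_cutEdges (σ := σ), h, ← mem_iff_forall_not_mem_cutEdges]
  subst hTT
  refine ⟨Equiv.ext fun j => ?_, rfl⟩
  by_cases hj : j ∈ T
  · have hhead : σ j ∈ T.image σ' := by
      rw [← spineHeads_cutEdges, ← h, spineHeads_cutEdges]
      exact mem_image_of_mem _ hj
    obtain ⟨t, ht, htj⟩ := mem_image.1 hhead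
    have hpath := hT.reflTransGen_of_sameCycle hj (Equiv.Perm.SameCycle.refl σ j)
    rw [h, ← htj] at hpath
    have htj' := hT'.eq ht hj
      (Equiv.Perm.sameCycle_apply_left.1 (sameCycle_of_reflTransGen hpath))
    rw [← htj, htj']
  · have hmem : (j, σ j) ∈ cutEdges σ' T := h ▸ mem_cutEdges.2 ⟨hj, rfl⟩
    exact (mem_cutEdges.1 hmem).2.symm

end CutEdges

section MultiSpine

variable {ℓ : ℕ} {E : Finset (Fin ℓ × Fin ℓ)}

lemma IsMultiSpine.exists_head (hE : IsMultiSpine ℓ E) (j : Fin ℓ) :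
    ∃ v, (∀ u, (u, v) ∉ E) ∧ Relation.ReflTransGen (edgeRel ℓ E) v j := by
  have : Std.Irrefl (Relation.TransGen (edgeRel ℓ E)) := ⟨hE.2.2⟩
  have hwf := Finite.wellFounded_of_trans_of_irrefl (Relation.TransGen (edgeRel ℓ E))
  induction j using hwf.induction with
  | _ j ih =>
    by_cases h : ∃ u, (u, j) ∈ E
    · obtain ⟨u, hu⟩ := h
      obtain ⟨v, hv, hvu⟩ := ih u (.single hu)
      exact ⟨v, hv, hvu.tail hu⟩
    · exact ⟨j, not_exists.1 h, .refl⟩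

lemma IsMultiSpine.exists_tail (hE : IsMultiSpine ℓ E) (j : Fin ℓ) :
    ∃ t, (∀ u, (t, u) ∉ E) ∧ Relation.ReflTransGen (edgeRel ℓ E) j t := by
  have : Std.Irrefl (Relation.TransGen (edgeRel ℓ E)) := ⟨hE.2.2⟩
  have : IsTrans (Fin ℓ) (Function.swap (Relation.TransGen (edgeRel ℓ E))) :=
    ⟨fun _ _ _ h h' => h'.trans h⟩
  have : Std.Irrefl (Function.swap (Relation.TransGen (edgeRel ℓ E))) := ⟨hE.2.2⟩
  have hwf := Finite.wellFounded_of_trans_of_irrefl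
    (Function.swap (Relation.TransGen (edgeRel ℓ E)))
  induction j using hwf.induction with
  | _ j ih =>
    by_cases h : ∃ u, (j, u) ∈ E
    · obtain ⟨u, hu⟩ := h
      obtain ⟨t, ht, hut⟩ := ih u (.single hu)
      exact ⟨t, ht, hut.head hu⟩
    · exact ⟨j, not_exists.1 h, .refl⟩

lemma IsMultiSpine.head_unique (hE : IsMultiSpine ℓ E) {v v' j : Fin ℓ}
    (hv : ∀ u, (u, v) ∉ E) (hv' : ∀ u, (u, v') ∉ E)
    (h : Relation.ReflTransGen (edgeRel ℓ E) v j)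
    (h' : Relation.ReflTransGen (edgeRel ℓ E) v' j) : v = v' := by
  have hU : Relator.RightUnique (Function.swap (edgeRel ℓ E)) :=
    fun a b c hab hac => hE.2.1 b c a hab hac
  rcases Relation.ReflTransGen.total_of_right_unique hU h.swap h'.swap with h1 | h1
  · rcases h1.cases_head with h2 | ⟨u, hu, -⟩
    · exact h2
    · exact (hv u hu).elim
  · rcases h1.cases_head with h2 | ⟨u, hu, -⟩
    · exact h2.symm
    · exact (hv' u hu).elim

lemma IsMultiSpine.tail_unique (hE : IsMultiSpine ℓ E) {t t' j : Fin ℓ}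
    (ht : ∀ u, (t, u) ∉ E) (ht' : ∀ u, (t', u) ∉ E)
    (h : Relation.ReflTransGen (edgeRel ℓ E) j t)
    (h' : Relation.ReflTransGen (edgeRel ℓ E) j t') : t = t' := by
  have hU : Relator.RightUnique (edgeRel ℓ E) := fun a b c hab hac => hE.1 a b c hab hac
  rcases Relation.ReflTransGen.total_of_right_unique hU h h' with h1 | h1
  · rcases h1.cases_head with h2 | ⟨u, hu, -⟩
    · exact h2
    · exact (ht u hu).elim
  · rcases h1.cases_head with h2 | ⟨u, hu, -⟩
    · exact h2.symm
    · exact (ht' u hu).elim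

/-- Every multi-spine graph arises by cutting each cycle of a permutation at one point. -/
lemma IsMultiSpine.exists_cutEdges (hE : IsMultiSpine ℓ E) :
    ∃ σ T, IsCycleTransversal σ T ∧ cutEdges (ℓ := ℓ) σ T = E := by
  choose head hhead hpath using hE.exists_head
  have hedge : ∀ i j, (i, j) ∈ E → head j = head i := fun i j hij =>
    hE.head_unique (hhead j) (hhead i) (hpath j) ((hpath i).tail hij)
  have hheadhead : ∀ j, head (head j) = head j := fun j =>
    hE.head_unique (hhead _) (hhead j) (hpath _) .refl
  let next : Fin ℓ → Fin ℓ := fun j => if h : ∃ k, (j, k) ∈ E then h.choose else head j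
  have hnext : ∀ j k, (j, k) ∈ E → next j = k := fun j k hjk => by
    have h : ∃ k, (j, k) ∈ E := ⟨k, hjk⟩
    simp only [next, dif_pos h]
    exact hE.1 j _ _ h.choose_spec hjk
  have hnext' : ∀ j, (∀ k, (j, k) ∉ E) → next j = head j := fun j hj => by
    simp only [next, dif_neg (not_exists.2 hj)]
  have hinj : Function.Injective next := by
    intro i j hij
    by_cases hi : ∃ k, (i, k) ∈ E <;> by_cases hj : ∃ k, (j, k) ∈ E
    · obtain ⟨k, hk⟩ := hi
      obtain ⟨m, hm⟩ := hj
      rw [hnext i k hk, hnext j m hm] at hij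
      exact hE.2.1 i j k hk (hij ▸ hm)
    · obtain ⟨k, hk⟩ := hi
      rw [hnext i k hk, hnext' j (not_exists.1 hj)] at hij
      exact (hhead j i (hij ▸ hk)).elim
    · obtain ⟨k, hk⟩ := hj
      rw [hnext j k hk, hnext' i (not_exists.1 hi)] at hij
      exact (hhead i j (hij ▸ hk)).elim
    · rw [hnext' i (not_exists.1 hi), hnext' j (not_exists.1 hj)] at hij
      exact hE.tail_unique (not_exists.1 hi) (not_exists.1 hj) (hpath i) (hij ▸ hpath j)
  let σ : Equiv.Perm (Fin ℓ) := Equiv.ofBijective next (Finite.injective_iff_bijective.1 hinj)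
  have hσ : ∀ j, σ j = next j := fun j => rfl
  have hheadσ : ∀ j, head (σ j) = head j := fun j => by
    by_cases hj : ∃ k, (j, k) ∈ E
    · obtain ⟨k, hk⟩ := hj
      rw [hσ, hnext j k hk, hedge j k hk]
    · rw [hσ, hnext' j (not_exists.1 hj), hheadhead]
  have hheadpow : ∀ (n : ℕ) j, head ((σ ^ n) j) = head j := fun n j => by
    induction n with
    | zero => rfl
    | succ n ih => rw [pow_succ', Equiv.Perm.mul_apply, hheadσ, ih]
  have hreach : ∀ i j, Relation.ReflTransGen (edgeRel ℓ E) i j → σ.SameCycle i j := by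
    intro i j h
    induction h with
    | refl => exact Equiv.Perm.SameCycle.refl _ _
    | tail _ hbc ih =>
      rw [← hnext _ _ hbc, ← hσ]
      exact ih.trans (Equiv.Perm.sameCycle_apply_right.2 (Equiv.Perm.SameCycle.refl _ _))
  refine ⟨σ, univ.filter fun j => ∀ k, (j, k) ∉ E, fun j => ?_, ?_⟩
  · obtain ⟨t, ht, hjt⟩ := hE.exists_tail j
    refine ⟨t, ⟨by simpa using ht, hreach _ _ hjt⟩, ?_⟩
    rintro t' ⟨ht', hjt'⟩
    obtain ⟨n, -, hn⟩ := ((hreach _ _ hjt).symm.trans hjt').exists_pow_eq'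
    have hhd : head t' = head t := by rw [← hn, hheadpow]
    exact hE.tail_unique (by simpa using ht') ht (hpath t') (hhd ▸ hpath t)
  · ext ⟨i, j⟩
    rw [mem_cutEdges, mem_filter, not_and, not_forall]
    constructor
    · rintro ⟨h, rfl⟩
      obtain ⟨k, hk⟩ := h (mem_univ i)
      rw [hσ, hnext i k (not_not.1 hk)]
      exact not_not.1 hk
    · exact fun h => ⟨fun _ => ⟨j, not_not.2 h⟩, hnext i j h⟩

end MultiSpine

/-- The contribution of a single permutation to the sum over multi-spine graphs. -/
lemma sum_cycleTransversal {ℓ : ℕ} (a x : Fin ℓ → ℝ) (ha : ∀ i, 0 < a i)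
    (hw : ∀ i j, x j - x i + a i ≠ 0) (σ : Equiv.Perm (Fin ℓ)) :
    ∑ T ∈ univ.filter (IsCycleTransversal σ), betaMS ℓ a (cutEdges σ T) /
        ∏ e ∈ cutEdges σ T, (x e.2 - x e.1 + a e.1) =
      (∏ j, a j) * ((Equiv.Perm.sign σ : ℤ) * ∏ j, (x (σ j) - x j + a j)⁻¹) := by
  set w : Fin ℓ → ℝ := fun j => x (σ j) - x j + a j with hwdef
  have hw0 : ∀ j, w j ≠ 0 := fun j => hw _ _
  set A : Fin ℓ → ℝ := fun j => ∑ i ∈ univ.filter (fun i => σ.SameCycle j i), a i with hA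
  have hApos : ∀ j, 0 < A j := fun j =>
    sum_pos (fun i _ => ha i) ⟨j, by simp [Equiv.Perm.SameCycle.refl]⟩
  have hterm : ∀ T, IsCycleTransversal σ T →
      betaMS ℓ a (cutEdges σ T) / ∏ e ∈ cutEdges σ T, (x e.2 - x e.1 + a e.1) =
        (-1) ^ ℓ * (∏ j, a j) * (∏ j, (w j)⁻¹) * ∏ t ∈ T, (w t / (-1 * A t)) := by
    intro T hT
    have hheads : ∏ v ∈ spineHeads ℓ (cutEdges σ T),
        ((-1) * ∑ i ∈ spineComponent ℓ (cutEdges σ T) v, a i) = ∏ t ∈ T, (-1 * A t) := by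
      rw [spineHeads_cutEdges, prod_image fun i _ j _ h => σ.injective h]
      exact prod_congr rfl fun t ht => by rw [hT.spineComponent_cutEdges ht]
    have hedges : ∏ e ∈ cutEdges σ T, (x e.2 - x e.1 + a e.1) = ∏ j ∈ Tᶜ, w j := by
      rw [cutEdges, prod_image fun i _ j _ h => congrArg Prod.fst h]
    have hsplit : (∏ j ∈ T, w j) * ∏ j ∈ Tᶜ, w j = ∏ j, w j := prod_mul_prod_compl T w
    have h1 : ∏ j ∈ T, w j ≠ 0 := prod_ne_zero_iff.2 fun j _ => hw0 j
    rw [betaMS, hheads, hedges, prod_inv_distrib, ← hsplit, prod_div_distrib]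
    field_simp
  have hfilter : univ.filter (IsCycleTransversal σ) =
      univ.filter (fun T : Finset (Fin ℓ) => ∀ q, ∃! t, t ∈ T ∧
        Quotient.mk (Equiv.Perm.SameCycle.setoid σ) t = q) := by
    refine filter_congr fun T _ => ?_
    rw [Quotient.forall]
    refine forall_congr' fun j => existsUnique_congr fun t => and_congr_right fun _ => ?_
    rw [Quotient.eq]
    exact Equiv.Perm.sameCycle_comm
  have hclass : ∀ q : Quotient (Equiv.Perm.SameCycle.setoid σ),
      ∑ t ∈ univ.filter (fun t => Quotient.mk (Equiv.Perm.SameCycle.setoid σ) t = q),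
        w t / (-1 * A t) = -1 := by
    intro q
    induction q using Quotient.inductionOn with
    | _ j =>
      have hset : univ.filter (fun t => Quotient.mk (Equiv.Perm.SameCycle.setoid σ) t =
          Quotient.mk _ j) = univ.filter fun i => σ.SameCycle j i := by
        refine filter_congr fun t _ => ?_
        rw [Quotient.eq]
        exact Equiv.Perm.sameCycle_comm
      have hAt : ∀ t, σ.SameCycle j t → A t = A j := fun t ht => by
        refine sum_congr (filter_congr fun i _ => ?_) fun _ _ => rfl
        exact ⟨ht.trans, ht.symm.trans⟩
      have hwA : ∑ t ∈ univ.filter (fun i => σ.SameCycle j i), w t = A j := by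
        have hx : ∑ t ∈ univ.filter (fun i => σ.SameCycle j i), x (σ t) =
            ∑ t ∈ univ.filter (fun i => σ.SameCycle j i), x t :=
          sum_equiv σ (fun t => by simp [Equiv.Perm.sameCycle_apply_right]) fun _ _ => rfl
        simp only [hwdef, sum_add_distrib, sum_sub_distrib, hx, sub_self, zero_add, hA]
      rw [hset, sum_congr rfl fun t ht => by rw [hAt t (mem_filter.1 ht).2], ← sum_div, hwA]
      have := (hApos j).ne'
      field_simp
  have hsum : ∑ T ∈ univ.filter (IsCycleTransversal σ), ∏ t ∈ T, (w t / (-1 * A t)) =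
      (-1) ^ Fintype.card (Quotient (Equiv.Perm.SameCycle.setoid σ)) := by
    rw [hfilter, sum_transversal_prod, ← card_univ]
    exact prod_eq_pow_card fun q _ => by convert hclass q
  rw [sum_congr rfl fun T hT => hterm T (mem_filter.1 hT).2, ← mul_sum, hsum,
    sign_eq_neg_one_pow_card_add_card_sameCycle, Fintype.card_fin]
  push_cast
  rw [pow_add]
  ring

/-- `Θ` expanded over multi-spine graphs, via the Cauchy determinant. -/
lemma sum_multiSpine_eq_Theta (ℓ : ℕ) (a x : Fin ℓ → ℝ) (ha : ∀ i, 0 < a i)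
    (hw : ∀ i j, x j - x i + a i ≠ 0) :
    ∑ E ∈ univ.filter (IsMultiSpine ℓ),
      betaMS ℓ a E / ∏ e ∈ E, (x e.2 - x e.1 + a e.1) = Theta ℓ a x := by
  have hbij : ∑ E ∈ univ.filter (IsMultiSpine ℓ),
      betaMS ℓ a E / ∏ e ∈ E, (x e.2 - x e.1 + a e.1) =
      ∑ σ : Equiv.Perm (Fin ℓ), ∑ T ∈ univ.filter (IsCycleTransversal σ),
        betaMS ℓ a (cutEdges σ T) / ∏ e ∈ cutEdges σ T, (x e.2 - x e.1 + a e.1) := by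
    rw [sum_sigma']
    symm
    refine sum_bij (fun p _ => cutEdges p.1 p.2) (fun p hp => ?_) (fun p hp p' hp' h => ?_)
      (fun E hE => ?_) fun p _ => rfl
    · simp only [mem_sigma, mem_filter, mem_univ, true_and] at hp ⊢
      exact hp.isMultiSpine
    · simp only [mem_sigma, mem_filter, mem_univ, true_and] at hp hp'
      obtain ⟨σ, T⟩ := p
      obtain ⟨σ', T'⟩ := p'
      obtain ⟨rfl, rfl⟩ := hp.cutEdges_injective hp' h
      rfl
    · obtain ⟨σ, T, hT, hE'⟩ := IsMultiSpine.exists_cutEdges (mem_filter.1 hE).2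
      exact ⟨⟨σ, T⟩, by simpa using hT, hE'⟩
  have hdet := det_cauchy ℓ x (fun j => x j - a j) fun i j => by
    have := hw j i
    rwa [show x i - (x j - a j) = x i - x j + a j by ring]
  rw [Matrix.det_apply'] at hdet
  rw [hbij, sum_congr rfl fun σ _ => sum_cycleTransversal a x ha hw σ, ← mul_sum]
  have hsum : ∑ σ : Equiv.Perm (Fin ℓ), ((Equiv.Perm.sign σ : ℤ) : ℝ) *
      ∏ j, (x (σ j) - x j + a j)⁻¹ =
      (∏ i, (a i)⁻¹) * Theta ℓ a x := by
    have hdiag : ∀ i, x i - (x i - a i) = a i := fun i => by ring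
    simp only [hdiag, Matrix.of_apply] at hdet
    convert hdet using 2
    · simp only [sub_sub_eq_add_sub, sub_add_eq_add_sub]
    · refine prod_congr rfl fun i _ => prod_congr rfl fun j _ => ?_
      have h1 := hw i j
      have h2 := hw j i
      have h3 : x i - x j - a i ≠ 0 := fun h => h1 (by linarith)
      have h4 : x j - (x i - a i) ≠ 0 := fun h => h1 (by linarith)
      have h5 : x i - (x j - a j) ≠ 0 := fun h => h2 (by linarith)
      rw [div_eq_div_iff (mul_ne_zero h2 h3) (mul_ne_zero h4 h5)]
      ring
  have hprod : ∏ i, a i ≠ 0 := prod_ne_zero_iff.2 fun i _ => (ha i).ne'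
  rw [hsum, prod_inv_distrib, mul_inv_cancel_left₀ hprod]

/-- The formula for the moments of a generic interlacing sequence in terms of
multi-spine graphs. -/
theorem momentM_eq_multiSpine_sum (L : ℕ) (X : Fin (L + 1) → ℝ) (Y : Fin L → ℝ)
    (hΛ : IsInterlacing L X Y) (hgen : IsGeneric L X) (u₀ : ℝ)
    (n : ℕ) (hn : 1 ≤ n) :
    momentM L X Y u₀ n =
      (n.factorial : ℝ) *
        ∑ c : Composition n, ∑ r ∈ decTuples L X u₀ c.length,
          (∏ i, (muWeight L X Y (r i) / (c.blocksFun i : ℝ)) *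
            ∏ t ∈ Finset.range (c.blocksFun i - 1),
              ∑ j : Fin (L + 1),
                muWeight L X Y j / (X j - X (r i) + ((t : ℝ) + 1))) *
          ∑ E ∈ univ.filter (IsMultiSpine c.length),
            betaMS c.length (fun i => (c.blocksFun i : ℝ)) E /
              ∏ e ∈ E, (X (r e.2) - X (r e.1) + (c.blocksFun e.1 : ℝ)) := by
  have hX : Function.Injective X := fun i j h => by
    by_contra hij
    exact hgen i j hij 0 (by simp [h])
  rw [momentM]
  congr 1
  refine sum_congr rfl fun c _ => sum_congr rfl fun r hr => ?_
  have hdec := (mem_filter.1 hr).2.1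
  have hrinj : Function.Injective r := fun i j h => by
    rcases lt_trichotomy i j with hij | hij | hij
    · exact absurd (hdec i j hij) (by simp [h])
    · exact hij
    · exact absurd (hdec j i hij) (by simp [h])
  have ha : ∀ i, (0 : ℝ) < c.blocksFun i := fun i => by
    exact_mod_cast c.one_le_blocksFun i
  have hw : ∀ i j, X (r j) - X (r i) + (c.blocksFun i : ℝ) ≠ 0 := fun i j h => by
    rcases eq_or_ne i j with rfl | hij
    · have := ha i
      rw [sub_self, zero_add] at h
      exact this.ne' h
    · refine hgen (r j) (r i) (fun h' => hij (hrinj h').symm) (-(c.blocksFun i : ℤ)) ?_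
      push_cast
      linarith
  rw [sum_multiSpine_eq_Theta _ _ (fun i => X (r i)) ha hw, mul_comm]
  congr 1
  refine prod_congr rfl fun i _ => ?_
  have hG : ∀ t : ℕ, cauchyG L X Y (X (r i) - 1 - t) =
      -1 * ∑ j, muWeight L X Y j / (X j - X (r i) + ((t : ℝ) + 1)) := fun t => by
    rw [cauchyG_eq_sum_muWeight L X Y hX, mul_sum]
    · refine sum_congr rfl fun j _ => ?_
      rw [show X (r i) - 1 - t - X j = -(X j - X (r i) + ((t : ℝ) + 1)) by ring, div_neg,
        neg_one_mul]
    · intro j h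
      rcases eq_or_ne (r i) j with rfl | hj
      · have : (0 : ℝ) ≤ t := t.cast_nonneg
        linarith
      · refine hgen (r i) j hj (t + 1) ?_
        push_cast
        linarith
  rw [cauchyGFall, prod_congr rfl fun t _ => hG t, prod_mul_distrib, prod_const, card_range]
  have hsq : ((-1 : ℝ) ^ (c.blocksFun i - 1)) * (-1) ^ (c.blocksFun i - 1) = 1 := by
    rw [← mul_pow]
    simp
  linear_combination (muWeight L X Y (r i) / c.blocksFun i *
    ∏ t ∈ range (c.blocksFun i - 1),
      ∑ j, muWeight L X Y j / (X j - X (r i) + ((t : ℝ) + 1))) * hsq
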